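/- arXiv:1810.05064 — 5 statements merged into one kernel-verified Lean document; each statement's English description precedes it below -/
import Mathlib

section
/- Let δ ≥ 1 and k ≥ 1 be integers, let p ∈ ℝ^δ, and let Q be a finite subset of ℝ^δ with p ∉ Q. Assume that for every q ∈ Q, the number of points q' ∈ Q with q' ≠ q and dist(q, q') < dist(q, p) is at most k − 1 (i.e., p is a k-nearest neighbor of every q ∈ Q within Q ∪ {p}). Then there exists a subset Q' ⊆ Q such that |Q| ≤ k · |Q'| and for every q ∈ Q' and every q' ∈ Q' with q' ≠ q one has dist(q, p) ≤ dist(q, q'). -/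
attribute [local instance] Classical.propDecidable

/-- Greedy selection: repeatedly keep a point farthest from `p` and discard the fewer than `k`
points that are closer to it than `p` is. -/
theorem exists_subset_card_le_mul_forall_dist_le {α : Type*} [PseudoMetricSpace α] {k : ℕ}
    (hk : 1 ≤ k) (p : α) (Q : Finset α)
    (hknn : ∀ q ∈ Q,
      (Q.filter (fun q' => q' ≠ q ∧ dist q q' < dist q p)).card ≤ k - 1) :
    ∃ Q' ⊆ Q, Q.card ≤ k * Q'.card ∧
      ∀ q ∈ Q', ∀ q' ∈ Q', q' ≠ q → dist q p ≤ dist q q' := by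
  induction Q using Finset.strongInduction with
  | H Q ih =>
    rcases Q.eq_empty_or_nonempty with rfl | hne
    · exact ⟨∅, by simp⟩
    obtain ⟨q, hq, hmax⟩ := Q.exists_max_image (fun x => dist x p) hne
    let C := Q.filter (fun q' => q' ≠ q ∧ dist q q' < dist q p)
    let R := (Q.erase q) \ C
    have hRQ : R ⊆ Q := Finset.sdiff_subset.trans (Finset.erase_subset q Q)
    have hqR : q ∉ R := by simp [R]
    have hR : R ⊂ Q := Finset.ssubset_iff_subset_ne.2 ⟨hRQ, fun h => hqR (h ▸ hq)⟩
    have hfar : ∀ x ∈ R, dist q p ≤ dist q x := by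
      intro x hx
      simp only [R, C, Finset.mem_sdiff, Finset.mem_erase, Finset.mem_filter] at hx
      exact not_lt.1 fun h => hx.2 ⟨hx.1.2, hx.1.1, h⟩
    obtain ⟨Q', hQ', hcard, hdist⟩ := ih R hR fun x hx =>
      (Finset.card_le_card (Finset.filter_subset_filter _ hRQ)).trans (hknn x (hRQ hx))
    refine ⟨insert q Q', Finset.insert_subset hq (hQ'.trans hRQ), ?_, ?_⟩
    · have hC : C.card ≤ k - 1 := hknn q hq
      have hsdiff : (Q.erase q).card - C.card ≤ R.card := Finset.le_card_sdiff C (Q.erase q)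
      have herase := Finset.card_erase_add_one hq
      rw [Finset.card_insert_of_notMem fun h => hqR (hQ' h), mul_add, mul_one]
      omega
    · intro x hx y hy hyx
      rcases Finset.mem_insert.1 hx with rfl | hx'
      · exact hfar y (hQ' ((Finset.mem_insert.1 hy).resolve_left hyx))
      · rcases Finset.mem_insert.1 hy with rfl | hy'
        · rw [dist_comm x y]
          exact (hmax x (hRQ (hQ' hx'))).trans (hfar x (hQ' hx'))
        · exact hdist x hx' y hy' hyx

/-- the `k`-reducing lemma. If every point of `Q` has `p` as a
`k`-nearest neighbor within `Q ∪ {p}`, then there is `Q' ⊆ Q` with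
`|Q| ≤ k * |Q'|` such that every point of `Q'` has `p` as a nearest neighbor
within `Q' ∪ {p}`. -/
theorem stmt0 (δ k : ℕ) (hδ : 1 ≤ δ) (hk : 1 ≤ k)
    (p : EuclideanSpace ℝ (Fin δ)) (Q : Finset (EuclideanSpace ℝ (Fin δ)))
    (hp : p ∉ Q)
    (hknn : ∀ q ∈ Q,
      (Q.filter (fun q' => q' ≠ q ∧ dist q q' < dist q p)).card ≤ k - 1) :
    ∃ Q' ⊆ Q, Q.card ≤ k * Q'.card ∧
      ∀ q ∈ Q', ∀ q' ∈ Q', q' ≠ q → dist q p ≤ dist q q' := by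
  exact exists_subset_card_le_mul_forall_dist_le hk p Q fun q hq => by convert hknn q hq
end

section
/- Let δ ≥ 1 and k ≥ 1 be integers and let ψ ≥ 0 be a real number. Let P be a finite subset of ℝ^δ and p ∈ P. Assume the following kissing-type hypothesis: for every subset Q ⊆ P \ {p} such that every q ∈ Q satisfies dist(q, p) ≤ dist(q, q') for all q' ∈ Q \ {q}, one has |Q| ≤ ψ. Then the number of points q ∈ P \ {p} that have p as a k-nearest neighbor, i.e., such that |{u ∈ P : u ≠ q and dist(q, u) < dist(q, p)}| ≤ k − 1, is at most k · ψ. -/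
attribute [local instance] Classical.propDecidable

/-- If each point of `S` has fewer than `k` other points of `S` strictly closer to it than `p`,
then `S` contains a subset of at least `S.card / k` points all having `p` as a nearest neighbor.
It is built greedily, by decreasing distance to `p`. -/
theorem exists_subset_nearest_card_le {X : Type*} [MetricSpace X] (p : X) (k : ℕ)
    (S : Finset X) (hpS : p ∉ S)
    (hS : ∀ q ∈ S, (S.filter (fun u => u ≠ q ∧ dist q u < dist q p)).card < k) :
    ∃ Q ⊆ S, (∀ q ∈ Q, ∀ q' ∈ Q, q' ≠ q → dist q p ≤ dist q q') ∧ S.card ≤ k * Q.card := by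
  induction S using Finset.strongInduction with
  | H S ih =>
    rcases S.eq_empty_or_nonempty with rfl | hne
    · exact ⟨∅, by simp⟩
    obtain ⟨q, hqS, hq⟩ := S.exists_max_image (fun u => dist u p) hne
    have hqp : 0 < dist q p := dist_pos.2 fun h => hpS (h ▸ hqS)
    set T := S.filter (fun u => dist q p ≤ dist q u) with hT
    have hTS : T ⊆ S := Finset.filter_subset _ _
    have hqT : q ∉ T := fun h => by
      have h' := (Finset.mem_filter.1 h).2
      rw [dist_self] at h'
      exact h'.not_gt hqp
    obtain ⟨Q, hQT, hQ, hcard⟩ := ih T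
      (Finset.ssubset_iff_subset_ne.2 ⟨hTS, fun h => hqT (h ▸ hqS)⟩) (fun h => hpS (hTS h))
      (fun u hu => (Finset.card_le_card (Finset.filter_subset_filter _ hTS)).trans_lt
        (hS u (hTS hu)))
    refine ⟨insert q Q, Finset.insert_subset hqS (hQT.trans hTS), ?_, ?_⟩
    · have hfar : ∀ u ∈ Q, dist q p ≤ dist q u := fun u hu =>
        (Finset.mem_filter.1 (hQT hu)).2
      intro a ha b hb hab
      rcases Finset.mem_insert.1 ha with rfl | ha' <;> rcases Finset.mem_insert.1 hb with rfl | hb'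
      · exact absurd rfl hab
      · exact hfar b hb'
      · rw [dist_comm a b]
        exact (hq a (hTS (hQT ha'))).trans (hfar a ha')
      · exact hQ a ha' b hb' hab
    · rw [Finset.card_insert_of_notMem fun h => hqT (hQT h)]
      have hsub : S ⊆ T ∪ insert q (S.filter (fun u => u ≠ q ∧ dist q u < dist q p)) := by
        intro u hu
        simp only [hT, Finset.mem_union, Finset.mem_insert, Finset.mem_filter]
        grind
      have h₁ := (Finset.card_le_card hsub).trans (Finset.card_union_le _ _)
      have h₂ := Finset.card_insert_le q (S.filter (fun u => u ≠ q ∧ dist q u < dist q p))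
      have h₃ := hS q hqS
      rw [mul_add, mul_one]
      omega

/-- Proposition 4 of the paper: under the kissing-type hypothesis with
parameter `ψ`, at most `k * ψ` points of `P \ {p}` have `p` as a `k`-nearest neighbor. -/
theorem stmt1 (δ k : ℕ) (hδ : 1 ≤ δ) (hk : 1 ≤ k) (ψ : ℝ) (hψ : 0 ≤ ψ)
    (P : Finset (EuclideanSpace ℝ (Fin δ))) (p : EuclideanSpace ℝ (Fin δ)) (hp : p ∈ P)
    (hkiss : ∀ Q ⊆ P.erase p,
      (∀ q ∈ Q, ∀ q' ∈ Q, q' ≠ q → dist q p ≤ dist q q') → (Q.card : ℝ) ≤ ψ) :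
    (((P.erase p).filter (fun q =>
        (P.filter (fun u => u ≠ q ∧ dist q u < dist q p)).card ≤ k - 1)).card : ℝ)
      ≤ k * ψ := by
  set S := (P.erase p).filter (fun q =>
    (P.filter (fun u => u ≠ q ∧ dist q u < dist q p)).card ≤ k - 1)
  have hSP : S ⊆ P.erase p := Finset.filter_subset _ _
  obtain ⟨Q, hQS, hQ, hcard⟩ := exists_subset_nearest_card_le p k S
    (fun h => Finset.notMem_erase p P (hSP h)) (fun q hq => by
      have h₁ := (Finset.mem_filter.1 hq).2
      have h₂ := Finset.card_le_card (Finset.filter_subset_filter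
        (fun u => u ≠ q ∧ dist q u < dist q p) (hSP.trans (Finset.erase_subset p P)))
      have h₃ : (S.filter (fun u => u ≠ q ∧ dist q u < dist q p)).card < k := by omega
      convert h₃)
  calc (S.card : ℝ) ≤ k * Q.card := by exact_mod_cast hcard
    _ ≤ k * ψ := by
      gcongr
      exact hkiss Q (hQS.trans hSP) hQ
end

section
/- Let δ ≥ 1, k ≥ 1, m ≥ 1 be integers and let p_1, …, p_m be pairwise distinct nonzero points of ℝ^δ such that for every i and every j ≠ i one has dist(p_i, 0) ≤ dist(p_i, p_j) (the origin is a nearest neighbor of each p_i among {0, p_1, …, p_m}). Consider the indexed family of k·m points f : Fin m × Fin k → ℝ^δ given by f(i, b) = p_i, together with the additional point 0. Then for every (i, a), the number of index pairs (j, b) ≠ (i, a) with dist(p_i, f(j, b)) < dist(p_i, 0) is at most k − 1; that is, the origin is a k-nearest neighbor of every one of the k·m members of the family. In particular, if m points can each have the origin as nearest neighbor, then k·m points (counted with multiplicity) can each have the origin as k-nearest neighbor. -/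
attribute [local instance] Classical.propDecidable

/-- Lemma 10 of the paper, tightness of the `k · ψ_δ` bound:
splitting each of `m` points that share the origin as nearest neighbor into `k`
coincident copies yields a family of `k·m` points, each of which has the origin
as a `k`-nearest neighbor. -/
theorem stmt2 (δ k m : ℕ) (hδ : 1 ≤ δ) (hk : 1 ≤ k) (hm : 1 ≤ m)
    (p : Fin m → EuclideanSpace ℝ (Fin δ))
    (hinj : Function.Injective p) (hne : ∀ i, p i ≠ 0)
    (hnn : ∀ i j, j ≠ i → dist (p i) 0 ≤ dist (p i) (p j))
    (f : Fin m × Fin k → EuclideanSpace ℝ (Fin δ)) (hf : ∀ ib, f ib = p ib.1) :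
    ∀ (i : Fin m) (a : Fin k),
      ((Finset.univ : Finset (Fin m × Fin k)).filter
        (fun jb => jb ≠ (i, a) ∧ dist (p i) (f jb) < dist (p i) 0)).card ≤ k - 1 := by
  intro i a
  have hsub : (Finset.univ : Finset (Fin m × Fin k)).filter
      (fun jb => jb ≠ (i, a) ∧ dist (p i) (f jb) < dist (p i) 0) ⊆
      (Finset.univ.erase a).image (Prod.mk i) := by
    rintro ⟨j, b⟩ hjb
    obtain ⟨hja, hlt⟩ := (Finset.mem_filter.mp hjb).2
    rw [hf] at hlt
    obtain rfl : j = i := by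
      by_contra hj
      exact (hnn i j hj).not_gt hlt
    have hba : b ≠ a := fun h => hja (by rw [h])
    exact Finset.mem_image_of_mem _ (Finset.mem_erase.mpr ⟨hba, Finset.mem_univ b⟩)
  calc _ ≤ ((Finset.univ.erase a).image (Prod.mk i)).card := Finset.card_le_card hsub
    _ ≤ (Finset.univ.erase a).card := Finset.card_image_le
    _ = k - 1 := by rw [Finset.card_erase_of_mem (Finset.mem_univ a), Finset.card_fin]
end

section
/- Let δ ≥ 1, k ≥ 1 be integers, let ε > 0 and d > 0 be reals, and let G = (V, E) be a geometric directed graph in ℝ^δ with n = |V| vertices. Suppose G is ε-far from being a k-NN graph with respect to degree bound d, i.e., for every edge set E' ⊆ V × V such that (V, E') with the same coordinate map is a k-NN graph, the symmetric difference E Δ E' has more than ε·d·n elements. Then the number of incomplete vertices of G is at least ε·d·n / (2k). -/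
attribute [local instance] Classical.propDecidable

/-- The out-neighborhood `N(v)` of a vertex in a directed graph given by an edge set. -/
noncomputable def nbrs {V : Type*} [Fintype V] (E : Finset (V × V)) (v : V) : Finset V :=
  Finset.univ.filter (fun u => (v, u) ∈ E)

/-- `(V, E)` with coordinates `coord` is a `k`-NN graph: every vertex `v` has a set `K`
of `min k (|V| - 1)` vertices other than `v`, all of them out-neighbors of `v`, that are
at least as close to `v` as every vertex outside `K ∪ {v}`. -/
def IsKNNGraph {V : Type*} [Fintype V] {δ : ℕ} (k : ℕ)
    (coord : V → EuclideanSpace ℝ (Fin δ)) (E : Finset (V × V)) : Prop :=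
  ∀ v : V, ∃ K : Finset V, v ∉ K ∧ K.card = min k (Fintype.card V - 1) ∧
    (∀ u ∈ K, (v, u) ∈ E) ∧
    ∀ u ∈ K, ∀ w : V, w ∉ K → w ≠ v →
      dist (coord v) (coord u) ≤ dist (coord v) (coord w)

/-- A vertex `v` is incomplete if `deg(v) < k` or some `k`-nearest neighbor `u` of `v`
is not an out-neighbor of `v`. -/
def Incomplete {V : Type*} [Fintype V] {δ : ℕ} (k : ℕ)
    (coord : V → EuclideanSpace ℝ (Fin δ)) (E : Finset (V × V)) (v : V) : Prop :=
  (nbrs E v).card < k ∨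
    ∃ u : V, u ≠ v ∧
      (Finset.univ.filter (fun w => w ≠ v ∧
        dist (coord v) (coord w) < dist (coord v) (coord u))).card ≤ k - 1 ∧
      (v, u) ∉ E

/-- In a finite set, any number `m ≤ s.card` of elements with smallest `f`-values can be chosen. -/
theorem exists_subset_card_eq_forall_le {V α : Type*} [LinearOrder α] (s : Finset V) (f : V → α)
    (m : ℕ) (hm : m ≤ s.card) :
    ∃ K ⊆ s, K.card = m ∧ ∀ u ∈ K, ∀ w ∈ s, w ∉ K → f u ≤ f w := by
  induction m with
  | zero => exact ⟨∅, by simp⟩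
  | succ m ih =>
    obtain ⟨K, hKs, hKm, hK⟩ := ih (by omega)
    have hne : (s \ K).Nonempty := by
      rw [← Finset.card_pos, Finset.card_sdiff_of_subset hKs]
      omega
    obtain ⟨x, hx, hmin⟩ := Finset.exists_min_image (s \ K) f hne
    rw [Finset.mem_sdiff] at hx
    refine ⟨insert x K, Finset.insert_subset hx.1 hKs, ?_, ?_⟩
    · rw [Finset.card_insert_of_notMem hx.2, hKm]
    · intro u hu w hw hwK
      rw [Finset.mem_insert, not_or] at hwK
      rcases Finset.mem_insert.mp hu with rfl | hu
      · exact hmin w (Finset.mem_sdiff.mpr ⟨hw, hwK.2⟩)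
      · exact hK u hu w hw hwK.2

/-- Lemma 3 of the paper: if `G` is `ε`-far from being a `k`-NN graph
with respect to degree bound `d`, then at least `ε·d·n / (2k)` vertices are incomplete. -/
theorem stmt3 (δ k : ℕ) (hδ : 1 ≤ δ) (hk : 1 ≤ k) (ε d : ℝ) (hε : 0 < ε) (hd : 0 < d)
    (V : Type*) [Fintype V] (coord : V → EuclideanSpace ℝ (Fin δ)) (E : Finset (V × V))
    (hfar : ∀ E' : Finset (V × V), IsKNNGraph k coord E' →
      ε * d * (Fintype.card V : ℝ) < ((symmDiff E E').card : ℝ)) :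
    ε * d * (Fintype.card V : ℝ) / (2 * k) ≤
      ((Finset.univ.filter (fun v => Incomplete k coord E v)).card : ℝ) := by
  have hex : ∀ v : V, ∃ K ⊆ Finset.univ.erase v, K.card = min k (Fintype.card V - 1) ∧
      ∀ u ∈ K, ∀ w ∈ Finset.univ.erase v, w ∉ K →
        dist (coord v) (coord u) ≤ dist (coord v) (coord w) := fun v =>
    exists_subset_card_eq_forall_le _ (fun u => dist (coord v) (coord u)) _ (by
      rw [Finset.card_erase_of_mem (Finset.mem_univ v), Finset.card_univ]
      exact min_le_right _ _)
  choose K hKsub hKcard hKmin using hex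
  have hKne : ∀ v, ∀ u ∈ K v, u ≠ v := fun v u hu => Finset.ne_of_mem_erase (hKsub v hu)
  set I := Finset.univ.filter (fun v => Incomplete k coord E v) with hI
  set A : Finset (V × V) := I.biUnion (fun v => (K v).image (fun u => (v, u))) with hA
  have hAcard : A.card ≤ I.card * k := by
    refine Finset.card_biUnion_le_card_mul _ _ _ fun v _ => Finset.card_image_le.trans ?_
    rw [hKcard]
    exact min_le_left _ _
  have hknn : IsKNNGraph k coord (E ∪ A) := by
    intro v
    refine ⟨K v, fun h => hKne v v h rfl, hKcard v, fun u hu => ?_, fun u hu w hw hwv =>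
      hKmin v u hu w (Finset.mem_erase.mpr ⟨hwv, Finset.mem_univ w⟩) hw⟩
    rw [Finset.mem_union]
    by_contra! hcon
    have hvI : v ∈ I := by
      refine Finset.mem_filter.mpr ⟨Finset.mem_univ v, Or.inr ⟨u, hKne v u hu, ?_, hcon.1⟩⟩
      have hsub : Finset.univ.filter (fun w => w ≠ v ∧
          dist (coord v) (coord w) < dist (coord v) (coord u)) ⊆ (K v).erase u := by
        intro w hw
        obtain ⟨-, hwv, hlt⟩ := Finset.mem_filter.mp hw
        refine Finset.mem_erase.mpr ⟨fun h => (h ▸ hlt).false, ?_⟩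
        by_contra hwK
        exact hlt.not_ge
          (hKmin v u hu w (Finset.mem_erase.mpr ⟨hwv, Finset.mem_univ w⟩) hwK)
      refine (Finset.card_le_card hsub).trans ?_
      rw [Finset.card_erase_of_mem hu, hKcard]
      exact Nat.sub_le_sub_right (min_le_left _ _) 1
    exact hcon.2 (Finset.mem_biUnion.mpr ⟨v, hvI, Finset.mem_image_of_mem _ hu⟩)
  have hsymm : symmDiff E (E ∪ A) ⊆ A := by
    intro e he
    simp only [Finset.mem_symmDiff, Finset.mem_union] at he
    tauto
  have hcard : ((symmDiff E (E ∪ A)).card : ℝ) ≤ I.card * k := by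
    exact_mod_cast (Finset.card_le_card hsymm).trans hAcard
  have hk0 : (0 : ℝ) < k := by exact_mod_cast hk
  rw [div_le_iff₀ (by positivity)]
  have hnonneg : (0 : ℝ) ≤ I.card * k := by positivity
  linarith [hfar _ hknn]
end

section
/- Let V be a finite set with |V| = n, let I ⊆ V with |I| = m, and let s, t be integers with 1 ≤ s ≤ n and t ≥ 1. Then the number of s-element subsets S of V with |S ∩ I| < t is at most (t·(n+1) / (s·(m+1))) · C(n, s), where C(n, s) is the binomial coefficient. Equivalently, for a uniformly random s-element subset S of V (sampling without replacement), the probability that S contains fewer than t elements of I is at most t·(n+1) / (s·(m+1)). -/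
open Finset in
theorem card_filter_powersetCard_inter_eq {α : Type*} [DecidableEq α] {V I : Finset α}
    (hIV : I ⊆ V) {s k : ℕ} (hk : k ≤ s) :
    #{S ∈ V.powersetCard s | #(S ∩ I) = k} = (#I).choose k * (#V - #I).choose (s - k) := by
  rw [← card_sdiff_of_subset hIV, ← card_powersetCard, ← card_powersetCard, ← card_product]
  refine card_nbij' (fun S => (S ∩ I, S \ I)) (fun p => p.1 ∪ p.2) ?_ ?_ ?_ ?_
  · intro S hS
    simp only [coe_filter, mem_powersetCard, Set.mem_ofPred_eq] at hS
    obtain ⟨⟨hSV, hS⟩, hSk⟩ := hS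
    simp only [coe_product, Set.mem_prod, mem_coe, mem_powersetCard]
    refine ⟨⟨inter_subset_right, hSk⟩, sdiff_subset_sdiff hSV subset_rfl, ?_⟩
    have := card_inter_add_card_sdiff S I
    omega
  · rintro ⟨A, B⟩ h
    simp only [coe_product, Set.mem_prod, mem_coe, mem_powersetCard] at h
    obtain ⟨⟨hA, hAk⟩, hB, hBk⟩ := h
    have hBI : Disjoint B I := disjoint_of_subset_left hB sdiff_disjoint
    simp only [coe_filter, mem_powersetCard, Set.mem_ofPred_eq]
    refine ⟨⟨union_subset (hA.trans hIV) (hB.trans sdiff_subset), ?_⟩, ?_⟩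
    · rw [card_union_of_disjoint (disjoint_of_subset_left hA hBI.symm)]
      omega
    · rw [union_inter_distrib_right, inter_eq_left.2 hA, disjoint_iff_inter_eq_empty.1 hBI,
        union_empty, hAk]
  · intro S _
    exact sup_inf_sdiff S I
  · rintro ⟨A, B⟩ h
    simp only [coe_product, Set.mem_prod, mem_coe, mem_powersetCard] at h
    obtain ⟨⟨hA, -⟩, hB, -⟩ := h
    have hBI : Disjoint B I := disjoint_of_subset_left hB sdiff_disjoint
    ext x
    · have : x ∈ A → x ∈ I := fun h => hA h
      have : x ∈ B → x ∉ I := fun h => disjoint_left.1 hBI h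
      simp only [mem_inter, mem_union]
      tauto
    · have : x ∈ A → x ∈ I := fun h => hA h
      have : x ∈ B → x ∉ I := fun h => disjoint_left.1 hBI h
      simp only [mem_sdiff, mem_union]
      tauto

theorem Nat.choose_mul_choose_sub (n a b : ℕ) :
    n.choose a * (n - a).choose b = n.choose (a + b) * (a + b).choose a := by
  rw [Nat.choose_mul (Nat.le_add_right a b), Nat.add_sub_cancel_left]

theorem Nat.choose_mul_choose_mul_choose_swap {n m s k : ℕ} (hkm : k ≤ m) (hks : k ≤ s) :
    m.choose k * (n - m).choose (s - k) * n.choose m =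
      s.choose k * (n - s).choose (m - k) * n.choose s := by
  have key : ∀ a b : ℕ, (k + a).choose k * (n - (k + a)).choose b * n.choose (k + a) =
      n.choose k * ((n - k).choose (a + b) * (a + b).choose a) := by
    intro a b
    rw [← Nat.choose_mul_choose_sub (n - k) a b, Nat.sub_sub, ← mul_assoc,
      Nat.choose_mul_choose_sub n k a]
    ring
  obtain ⟨a, rfl⟩ := Nat.exists_eq_add_of_le hkm
  obtain ⟨b, rfl⟩ := Nat.exists_eq_add_of_le hks
  rw [Nat.add_sub_cancel_left, Nat.add_sub_cancel_left, key a b, key b a, add_comm b a,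
    Nat.choose_symm_add]

open Finset in
theorem Nat.sum_range_choose_mul_choose (n k l : ℕ) :
    ∑ j ∈ range (n + 1), j.choose k * (n - j).choose l = (n + 1).choose (k + l + 1) := by
  induction n generalizing l with
  | zero => cases k <;> cases l <;> simp [Nat.choose_eq_zero_of_lt]
  | succ n ih =>
    cases l with
    | zero =>
      rw [sum_range_succ, Nat.choose_succ_succ (n + 1), add_comm]
      simpa using ih 0
    | succ l =>
      have h : ∀ j ∈ range (n + 1), j.choose k * (n + 1 - j).choose (l + 1) =
          j.choose k * (n - j).choose l + j.choose k * (n - j).choose (l + 1) := by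
        intro j hj
        rw [Nat.succ_sub (Nat.lt_succ_iff.1 (mem_range.1 hj)), Nat.choose_succ_succ, mul_add]
      rw [sum_range_succ, sum_congr rfl h, sum_add_distrib, ih, ih, Nat.sub_self,
        Nat.choose_zero_succ, mul_zero, add_zero, Nat.choose_succ_succ (n + 1)]
      rfl

open Finset in
theorem Nat.sum_range_choose_mul_choose_succ (s r m t : ℕ) (ht : t < m) :
    ∑ k ∈ range (t + 1), s.choose k * (r + 1).choose (m - k) =
      ∑ k ∈ range (t + 1), (s + 1).choose k * r.choose (m - k) +
        s.choose t * r.choose (m - (t + 1)) := by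
  induction t with
  | zero =>
    obtain ⟨m, rfl⟩ := Nat.exists_eq_succ_of_ne_zero ht.ne'
    simp [Nat.choose_succ_succ, add_comm]
  | succ t ih =>
    rw [sum_range_succ, ih (by omega), sum_range_succ _ (t + 1), Nat.choose_succ_succ s t]
    obtain ⟨l, hl⟩ := Nat.exists_eq_add_of_lt ht
    rw [show m - (t + 1) = l + 1 by omega, show m - (t + 1 + 1) = l by omega,
      Nat.choose_succ_succ r l]
    simp only [Nat.succ_eq_add_one]
    ring

open Finset in
theorem Nat.mul_sum_range_choose_mul_choose_le {n m s t : ℕ} (hs : s ≤ n) (ht : t ≤ m) :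
    s * ∑ k ∈ range t, s.choose k * (n - s).choose (m - k) ≤
      t * (n + 1).choose (m + 1) := by
  set b : ℕ → ℕ := fun j => ∑ k ∈ range t, j.choose k * (n - j).choose (m - k) with hb
  have hanti : ∀ j, j < n → b (j + 1) ≤ b j := by
    intro j hj
    obtain ⟨r, rfl⟩ := Nat.exists_eq_add_of_lt hj
    cases t with
    | zero => simp [hb]
    | succ t =>
      simp only [hb]
      rw [show j + r + 1 - j = r + 1 by omega, show j + r + 1 - (j + 1) = r by omega,
        Nat.sum_range_choose_mul_choose_succ j r m t ht]
      exact Nat.le_add_right _ _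
  have hle : ∀ j ≤ s, b s ≤ b j := by
    intro j hj
    exact Nat.decreasingInduction (motive := fun j _ => b s ≤ b j)
      (fun i hi h => h.trans (hanti i (hi.trans_le hs))) le_rfl hj
  calc s * b s = ∑ _j ∈ range s, b s := by simp
    _ ≤ ∑ j ∈ range s, b j := sum_le_sum fun j hj => hle j (mem_range.1 hj).le
    _ ≤ ∑ j ∈ range (n + 1), b j :=
        sum_le_sum_of_subset (range_subset_range.2 (by omega))
    _ = ∑ k ∈ range t, ∑ j ∈ range (n + 1), j.choose k * (n - j).choose (m - k) := sum_comm
    _ = ∑ _k ∈ range t, (n + 1).choose (m + 1) := by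
        refine sum_congr rfl fun k hk => ?_
        have hkt := mem_range.1 hk
        rw [Nat.sum_range_choose_mul_choose, show k + (m - k) = m by omega]
    _ = t * (n + 1).choose (m + 1) := by simp

open Finset in
theorem card_filter_powersetCard_inter_lt_mul_choose {α : Type*} [DecidableEq α]
    {V I : Finset α} (hIV : I ⊆ V) (s : ℕ) {t : ℕ} (ht : t ≤ #I) :
    #{S ∈ V.powersetCard s | #(S ∩ I) < t} * (#V).choose #I =
      (∑ k ∈ range t, s.choose k * (#V - s).choose (#I - k)) * (#V).choose s := by
  rw [card_eq_sum_card_fiberwise (f := fun S => #(S ∩ I)) (t := range t)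
    (fun S hS => by simpa using (mem_filter.1 hS).2), sum_mul, sum_mul]
  refine sum_congr rfl fun k hk => ?_
  have hkt := mem_range.1 hk
  rw [filter_filter, filter_congr (q := fun S => #(S ∩ I) = k) (by grind)]
  rcases le_or_gt k s with hks | hks
  · rw [card_filter_powersetCard_inter_eq hIV hks,
      Nat.choose_mul_choose_mul_choose_swap (by omega) hks]
  · rw [Nat.choose_eq_zero_of_lt hks, filter_eq_empty_iff.2]
    · simp
    · intro S hS h
      have := card_le_card (inter_subset_left (s₁ := S) (s₂ := I))
      have := (mem_powersetCard.1 hS).2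
      omega

open Finset in
theorem mul_card_filter_powersetCard_inter_lt_le {α : Type*} [DecidableEq α]
    {V I : Finset α} (hIV : I ⊆ V) {s : ℕ} (hs : s ≤ #V) (t : ℕ) :
    s * (#I + 1) * #{S ∈ V.powersetCard s | #(S ∩ I) < t} ≤
      t * (#V + 1) * (#V).choose s := by
  rcases le_or_gt t #I with ht | ht
  · refine Nat.le_of_mul_le_mul_right ?_ (Nat.choose_pos (card_le_card hIV))
    calc s * (#I + 1) * #{S ∈ V.powersetCard s | #(S ∩ I) < t} * (#V).choose #I
        = (s * ∑ k ∈ range t, s.choose k * (#V - s).choose (#I - k)) *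
            ((#I + 1) * (#V).choose s) := by
          rw [mul_assoc, card_filter_powersetCard_inter_lt_mul_choose hIV s ht]
          ring
      _ ≤ t * (#V + 1).choose (#I + 1) * ((#I + 1) * (#V).choose s) :=
          Nat.mul_le_mul_right _ (Nat.mul_sum_range_choose_mul_choose_le hs ht)
      _ = t * ((#V + 1).choose (#I + 1) * (#I + 1)) * (#V).choose s := by ring
      _ = t * (#V + 1) * (#V).choose s * (#V).choose #I := by
          rw [← Nat.add_one_mul_choose_eq]
          ring
  · refine Nat.mul_le_mul ?_ ((card_filter_le _ _).trans_eq (card_powersetCard s V))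
    rw [mul_comm]
    exact Nat.mul_le_mul ht (by omega)

/-- counting form of Lemma 7 of the paper: for a uniformly random
`s`-element subset `S` of `V` (sampling without replacement), the probability that
`S` contains fewer than `t` elements of `I` is at most `t·(n+1) / (s·(m+1))`. -/
theorem stmt5 {α : Type*} [DecidableEq α] (V I : Finset α) (hIV : I ⊆ V)
    (s t : ℕ) (hs1 : 1 ≤ s) (hsn : s ≤ V.card) (ht : 1 ≤ t) :
    (((V.powersetCard s).filter (fun S => (S ∩ I).card < t)).card : ℝ) ≤
      ((t : ℝ) * (V.card + 1) / (s * (I.card + 1))) * ((V.card).choose s : ℝ) := by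
  have hs : (0 : ℝ) < s * (I.card + 1) := by positivity
  rw [div_mul_eq_mul_div, le_div_iff₀ hs, mul_comm]
  exact_mod_cast mul_card_filter_powersetCard_inter_lt_le hIV hsn t
end
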